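/- If 0 < v₀ < v, then for every s ∈ [s₋∞,1) one has (v²/v₀²) Φ(𝔐_{v₀}(s)) ≤ Φ(𝔐_v(s)), and Φ(𝔐_v(s)) ≤ (v/γ)² 𝒢(s) whenever 𝔐_v(s) > 0. In particular, for each fixed s ∈ [s₋∞,1), 𝔐_v(s) → 0 as v → 0⁺. -/

import Mathlib

/-- The M-map `𝔐_v`: continuous on `[s₋∞,1]`, zero at `1`, positive (and `< 1`)
exactly on `(σ,1)`, zero on `[s₋∞,σ]`, satisfying the integrated ODE
`Φ(𝔐_v(s)) = (v²/γ) ∫_s^1 (𝔐_v(ρ) − ℓ(ρ))/f(ρ) dρ` on `(σ,1)`, and such that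
`∫_s^1 dρ/(f(ρ)𝔐_v(ρ)) < ∞` for some `s ∈ (σ,1)`. -/
def IsMMap (gam v sInf sigma : ℝ) (f ell Phi Mv : ℝ → ℝ) : Prop :=
  ContinuousOn Mv (Set.Icc sInf 1) ∧ Mv 1 = 0 ∧ sigma ∈ Set.Icc sInf 1 ∧
  (∀ s ∈ Set.Ioo sigma 1, 0 < Mv s ∧ Mv s < 1) ∧
  (∀ s ∈ Set.Icc sInf sigma, Mv s = 0) ∧
  (∀ s ∈ Set.Ioo sigma 1,
    Phi (Mv s) = v ^ 2 / gam * ∫ ρ in s..1, (Mv ρ - ell ρ) / f ρ) ∧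
  (∃ s ∈ Set.Ioo sigma 1,
    IntervalIntegrable (fun ρ => 1 / (f ρ * Mv ρ)) MeasureTheory.volume s 1)

section aux
open Set MeasureTheory intervalIntegral

lemma aux_ii {g : ℝ → ℝ} (hg : ContinuousOn g (Ico (0:ℝ) 1)) {x y : ℝ} (hx : x ∈ Ico (0:ℝ) 1)
    (hy : y ∈ Ico (0:ℝ) 1) : IntervalIntegrable g volume x y := by
  apply ContinuousOn.intervalIntegrable
  apply hg.mono
  exact (ordConnected_Ico.uIcc_subset hx hy)

lemma aux_smono {g : ℝ → ℝ} (hg : ContinuousOn g (Ico (0:ℝ) 1)) (hp : ∀ x ∈ Ioo (0:ℝ) 1, 0 < g x) :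
    StrictMonoOn (fun m => ∫ ρ in (0:ℝ)..m, g ρ) (Ico (0:ℝ) 1) := by
  intro x hx y hy hxy
  have h0 : (0:ℝ) ∈ Ico (0:ℝ) 1 := by simp
  have h := integral_add_adjacent_intervals (aux_ii hg h0 hx) (aux_ii hg hx hy)
  have : 0 < ∫ ρ in x..y, g ρ := by
    apply intervalIntegral_pos_of_pos_on (aux_ii hg hx hy) _ hxy
    intro u hu
    exact hp u ⟨hx.1.trans_lt hu.1, hu.2.trans hy.2⟩
  simp only
  linarith

lemma aux_strict {g : ℝ → ℝ} (hg : ContinuousOn g (Ico (0:ℝ) 1)) {m : ℝ} (hm : m ∈ Ioo (0:ℝ) 1) :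
    HasStrictDerivAt (fun m => ∫ ρ in (0:ℝ)..m, g ρ) (g m) m := by
  have h0 : (0:ℝ) ∈ Ico (0:ℝ) 1 := by simp
  apply integral_hasStrictDerivAt_right (aux_ii hg h0 ⟨hm.1.le, hm.2⟩)
  · exact (hg.mono Ioo_subset_Ico_self).stronglyMeasurableAtFilter isOpen_Ioo m hm
  · exact (hg.mono Ioo_subset_Ico_self).continuousAt (isOpen_Ioo.mem_nhds hm)

lemma aux_cont {g : ℝ → ℝ} (hg : ContinuousOn g (Ico (0:ℝ) 1)) :
    ContinuousOn (fun m => ∫ ρ in (0:ℝ)..m, g ρ) (Ico (0:ℝ) 1) := by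
  intro x hx
  obtain ⟨b, hxb, hb⟩ := exists_between hx.2
  have hb0 : 0 ≤ b := hx.1.trans hxb.le
  have h : ContinuousOn (fun m => ∫ ρ in (0:ℝ)..m, g ρ) (Icc 0 b) := by
    have := continuousOn_primitive_interval (μ := volume) (f := g) (a := 0) (b := b) (by
      rw [uIcc_of_le hb0]
      exact (hg.mono (Icc_subset_Ico_right hb)).integrableOn_Icc)
    rwa [uIcc_of_le hb0] at this
  have h2 := h x ⟨hx.1, hxb.le⟩
  apply h2.mono_of_mem_nhdsWithin
  filter_upwards [self_mem_nhdsWithin, nhdsWithin_le_nhds (Iio_mem_nhds hxb)] with u hu hu2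
  exact ⟨hu.1, le_of_lt hu2⟩

lemma key_identity {D M f ell : ℝ → ℝ} {s c : ℝ} (hs : s < 1)
    (hD : ContinuousOn D (Ico (0:ℝ) 1)) (hDp : ∀ x ∈ Ioo (0:ℝ) 1, 0 < D x)
    (hM : ContinuousOn M (Icc s 1)) (hM1 : M 1 = 0) (hMp : ∀ u ∈ Ico s 1, M u ∈ Ioo (0:ℝ) 1)
    (hf : ContinuousOn f (Icc s 1)) (hfp : ∀ u ∈ Icc s 1, 0 < f u)
    (hell : ContinuousOn ell (Icc s 1))
    (hE : ∀ u ∈ Ico s 1, (∫ ρ in (0:ℝ)..(M u), ρ * D ρ) = c * ∫ ρ in u..1, (M ρ - ell ρ) / f ρ)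
    (hI : IntervalIntegrable (fun ρ => 1 / (f ρ * M ρ)) volume s 1) :
    (∫ ρ in (0:ℝ)..(M s), D ρ) = c * ∫ ρ in s..1, (1 / f ρ - ell ρ * (1 / (f ρ * M ρ))) := by
  have hq : ContinuousOn (fun ρ => (M ρ - ell ρ) / f ρ) (Icc s 1) :=
    (hM.sub hell).div hf (fun u hu => (hfp u hu).ne')
  have hmaps : MapsTo M (Icc s 1) (Ico 0 1) := by
    intro u hu
    rcases eq_or_lt_of_le hu.2 with h | h
    · rw [h, hM1]; simp
    · exact Ioo_subset_Ico_self (hMp u ⟨hu.1, h⟩)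
  have hid : ContinuousOn (fun ρ => ρ * D ρ) (Ico (0:ℝ) 1) := continuousOn_id.mul hD
  have hderiv : ∀ u ∈ Ioo s 1, HasDerivAt (fun u => ∫ ρ in (0:ℝ)..(M u), D ρ)
      (-(c * (1 / f u - ell u * (1 / (f u * M u))))) u := by
    intro u hu
    have hMu := hMp u ⟨hu.1.le, hu.2⟩
    have hDu := hDp _ hMu
    have hfu := hfp u ⟨hu.1.le, hu.2.le⟩
    have hnhds : Icc s 1 ∈ nhds u := Icc_mem_nhds hu.1 hu.2
    have hMc : ContinuousAt M u := hM.continuousAt hnhds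
    have hP := aux_strict hid hMu
    have hne : M u * D (M u) ≠ 0 := (mul_pos hMu.1 hDu).ne'
    have hW : HasDerivAt (fun u => ∫ ρ in (0:ℝ)..(M u), ρ * D ρ)
        (c * (-((M u - ell u) / f u))) u := by
      have h1 : HasDerivAt (fun u => ∫ ρ in u..1, (M ρ - ell ρ) / f ρ) (-((M u - ell u) / f u)) u := by
        apply integral_hasDerivAt_left
        · apply ContinuousOn.intervalIntegrable
          rw [uIcc_of_le hu.2.le]
          exact hq.mono (Icc_subset_Icc_left hu.1.le)
        · exact (hq.mono Ioo_subset_Icc_self).stronglyMeasurableAtFilter isOpen_Ioo u hu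
        · exact hq.continuousAt hnhds
      apply (h1.const_mul c).congr_of_eventuallyEq
      filter_upwards [Ioo_mem_nhds hu.1 hu.2] with w hw
      exact hE w ⟨hw.1.le, hw.2⟩
    have hL := hP.to_localInverse hne
    have hMd : HasDerivAt M ((M u * D (M u))⁻¹ * (c * (-((M u - ell u) / f u)))) u := by
      have h2 := hL.hasDerivAt.comp u hW
      apply h2.congr_of_eventuallyEq
      have h3 := hP.hasStrictFDerivAt_equiv hne |>.eventually_left_inverse
      have h4 := hMc.eventually h3
      filter_upwards [h4] with w hw
      exact hw.symm
    have hDd := (aux_strict hD hMu).hasDerivAt.comp u hMd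
    refine hDd.congr_deriv ?_
    have := hMu.1.ne'
    have := hDu.ne'
    have := hfu.ne'
    field_simp
  have hint : IntervalIntegrable (fun u => (1 / f u - ell u * (1 / (f u * M u)))) volume s 1 := by
    apply IntervalIntegrable.sub
    · apply ContinuousOn.intervalIntegrable
      rw [uIcc_of_le hs.le]
      exact continuousOn_const.div hf (fun u hu => (hfp u hu).ne')
    · apply hI.continuousOn_mul
      rwa [uIcc_of_le hs.le]
  have hfin := integral_eq_sub_of_hasDerivAt_of_le hs.le ((aux_cont hD).comp hM hmaps) hderiv
    (hint.const_mul c).neg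
  rw [intervalIntegral.integral_neg, intervalIntegral.integral_const_mul] at hfin
  simp only [Function.comp, hM1, integral_same] at hfin
  linarith

lemma near_one {D M N f ell : ℝ → ℝ} {s c c0 K : ℝ} (hs : s < 1) (hc0 : 0 < c0) (hc : c0 < c)
    (hK : 0 < K)
    (hD : ContinuousOn D (Ico (0:ℝ) 1)) (hDp : ∀ x ∈ Ioo (0:ℝ) 1, 0 < D x)
    (hM : ContinuousOn M (Icc s 1)) (hM1 : M 1 = 0) (hMp : ∀ u ∈ Ico s 1, M u ∈ Ioo (0:ℝ) 1)
    (hN : ContinuousOn N (Icc s 1)) (hN1 : N 1 = 0) (hNp : ∀ u ∈ Ico s 1, N u ∈ Ioo (0:ℝ) 1)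
    (hf : ContinuousOn f (Icc s 1)) (hfp : ∀ u ∈ Icc s 1, 0 < f u)
    (hf1 : ∀ u ∈ Icc s 1, f u ≤ 1)
    (hell : ContinuousOn ell (Icc s 1))
    (hell0 : ∀ u ∈ Icc s 1, 0 ≤ ell u) (hellK : ∀ u ∈ Icc s 1, ell u ≤ K * (1 - u))
    (hE : ∀ u ∈ Ico s 1, (∫ ρ in (0:ℝ)..(M u), ρ * D ρ) = c * ∫ ρ in u..1, (M ρ - ell ρ) / f ρ)
    (hEN : ∀ u ∈ Ico s 1, (∫ ρ in (0:ℝ)..(N u), ρ * D ρ) = c0 * ∫ ρ in u..1, (N ρ - ell ρ) / f ρ)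
    (hI : IntervalIntegrable (fun ρ => 1 / (f ρ * M ρ)) volume s 1)
    (hIN : IntervalIntegrable (fun ρ => 1 / (f ρ * N ρ)) volume s 1) :
    ∃ t ∈ Ico s 1, ∀ u ∈ Ico t 1, N u < M u := by
  have hcp : 0 < c := hc0.trans hc
  have hJ : ContinuousOn (fun x => ∫ ρ in x..1, 1 / (f ρ * M ρ)) (Icc s 1) := by
    have := continuousOn_primitive_interval_left (μ := volume) (f := fun ρ => 1 / (f ρ * M ρ))
      (a := s) (b := 1) (by
        rw [uIcc_of_le hs.le]
        exact (intervalIntegrable_iff_integrableOn_Icc_of_le hs.le).1 hI)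
    rwa [uIcc_of_le hs.le] at this
  have hev : ∀ᶠ x in nhdsWithin 1 (Icc s 1), (∫ ρ in x..1, 1 / (f ρ * M ρ)) < (c - c0) / (c * K) := by
    have h1 := hJ 1 ⟨hs.le, le_rfl⟩
    apply h1.eventually_lt_const
    simp only [integral_same]
    exact div_pos (by linarith) (mul_pos hcp hK)
  rw [Filter.Eventually, mem_nhdsWithin_iff_exists_mem_nhds_inter] at hev
  obtain ⟨U, hU, hUs⟩ := hev
  obtain ⟨l, hl, hlU⟩ := exists_Ioc_subset_of_mem_nhds hU ⟨s, hs⟩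
  obtain ⟨t, ht1, ht2⟩ := exists_between (max_lt hl hs)
  have hst : s < t := (le_max_right _ _).trans_lt ht1
  refine ⟨t, ⟨hst.le, ht2⟩, ?_⟩
  intro u hu
  have hsu : s ≤ u := hst.le.trans hu.1
  have huI : u ∈ Ico s 1 := ⟨hsu, hu.2⟩
  have hsub : Icc u 1 ⊆ Icc s 1 := Icc_subset_Icc_left hsu
  have hsubo : Ico u 1 ⊆ Ico s 1 := Ico_subset_Ico_left hsu
  have hsm : ∫ ρ in u..1, 1 / (f ρ * M ρ) < (c - c0) / (c * K) := by
    have : u ∈ U := hlU ⟨(le_max_left _ _).trans_lt (ht1.trans_le hu.1), hu.2.le⟩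
    exact hUs ⟨this, hsu, hu.2.le⟩
  have hIu : IntervalIntegrable (fun ρ => 1 / (f ρ * M ρ)) volume u 1 :=
    hI.mono_set (by rw [uIcc_of_le hu.2.le, uIcc_of_le hs.le]; exact hsub)
  have hINu : IntervalIntegrable (fun ρ => 1 / (f ρ * N ρ)) volume u 1 :=
    hIN.mono_set (by rw [uIcc_of_le hu.2.le, uIcc_of_le hs.le]; exact hsub)
  have h1 := key_identity hu.2 hD hDp (hM.mono hsub) hM1 (fun w hw => hMp w (hsubo hw))
    (hf.mono hsub) (fun w hw => hfp w (hsub hw)) (hell.mono hsub) (fun w hw => hE w (hsubo hw)) hIu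
  have h2 := key_identity hu.2 hD hDp (hN.mono hsub) hN1 (fun w hw => hNp w (hsubo hw))
    (hf.mono hsub) (fun w hw => hfp w (hsub hw)) (hell.mono hsub) (fun w hw => hEN w (hsubo hw)) hINu
  have hfi : IntervalIntegrable (fun ρ => 1 / f ρ) volume u 1 := by
    apply ContinuousOn.intervalIntegrable
    rw [uIcc_of_le hu.2.le]
    exact continuousOn_const.div (hf.mono hsub) (fun w hw => (hfp w (hsub hw)).ne')
  have hellu : ContinuousOn ell (uIcc u 1) := by
    rw [uIcc_of_le hu.2.le]; exact hell.mono hsub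
  have hMi := hIu.continuousOn_mul hellu
  have hNi := hINu.continuousOn_mul hellu
  rw [integral_sub hfi hMi] at h1
  rw [integral_sub hfi hNi] at h2
  have hN0 : 0 ≤ ∫ ρ in u..1, ell ρ * (1 / (f ρ * N ρ)) := by
    apply integral_nonneg hu.2.le
    intro w hw
    have hw' := hsub hw
    have hNw : 0 ≤ N w := by
      rcases eq_or_lt_of_le hw'.2 with h | h
      · rw [h, hN1]
      · exact (hNp w ⟨hw'.1, h⟩).1.le
    have := hell0 w hw'
    have := hfp w hw'
    positivity
  have hMb : ∫ ρ in u..1, ell ρ * (1 / (f ρ * M ρ)) ≤ K * (1 - u) * ∫ ρ in u..1, 1 / (f ρ * M ρ) := by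
    rw [← intervalIntegral.integral_const_mul]
    apply integral_mono_on hu.2.le hMi (hIu.const_mul _)
    intro w hw
    have hw' := hsub hw
    have hMw : 0 ≤ M w := by
      rcases eq_or_lt_of_le hw'.2 with h | h
      · rw [h, hM1]
      · exact (hMp w ⟨hw'.1, h⟩).1.le
    have := hfp w hw'
    apply mul_le_mul_of_nonneg_right _ (by positivity)
    apply (hellK w hw').trans
    apply mul_le_mul_of_nonneg_left _ hK.le
    linarith [hw.1]
  have hone : 1 - u ≤ ∫ ρ in u..1, 1 / f ρ := by
    have : ∫ ρ in u..1, (1:ℝ) = 1 - u := by simp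
    rw [← this]
    apply integral_mono_on hu.2.le (by simp) hfi
    intro w hw
    rw [le_div_iff₀ (hfp w (hsub hw)), one_mul]
    exact hf1 w (hsub hw)
  have hlt : (∫ ρ in (0:ℝ)..(N u), D ρ) < ∫ ρ in (0:ℝ)..(M u), D ρ := by
    rw [h1, h2]
    have hu1 : 0 < 1 - u := by linarith [hu.2]
    have e1 : c * ∫ ρ in u..1, ell ρ * (1 / (f ρ * M ρ)) < (c - c0) * (1 - u) := by
      calc _ ≤ c * (K * (1 - u) * ∫ ρ in u..1, 1 / (f ρ * M ρ)) :=
            mul_le_mul_of_nonneg_left hMb hcp.le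
        _ = (1 - u) * ((c * K) * ∫ ρ in u..1, 1 / (f ρ * M ρ)) := by ring
        _ < (1 - u) * (c - c0) := by
            apply mul_lt_mul_of_pos_left _ hu1
            rw [lt_div_iff₀ (mul_pos hcp hK)] at hsm
            linarith
        _ = _ := by ring
    have e2 : (c - c0) * (1 - u) ≤ (c - c0) * ∫ ρ in u..1, 1 / f ρ :=
      mul_le_mul_of_nonneg_left hone (by linarith)
    have e3 := mul_nonneg hc0.le hN0
    rw [mul_sub, mul_sub]
    linarith [sub_mul c c0 (∫ ρ in u..1, 1 / f ρ)]
  exact ((aux_smono hD hDp).lt_iff_lt (Ioo_subset_Ico_self (hNp u huI))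
    (Ioo_subset_Ico_self (hMp u huI))).1 hlt

lemma global_comp {D M N f ell : ℝ → ℝ} {m c c0 t : ℝ} (hc0 : 0 < c0) (hc : c0 < c)
    (hD : ContinuousOn D (Ico (0:ℝ) 1)) (hDp : ∀ x ∈ Ioo (0:ℝ) 1, 0 < D x)
    (hM : ContinuousOn M (Icc m 1)) (hMp : ∀ u ∈ Ioo m 1, M u ∈ Ioo (0:ℝ) 1)
    (hN : ContinuousOn N (Icc m 1)) (hNp : ∀ u ∈ Ioo m 1, N u ∈ Ioo (0:ℝ) 1)
    (hf : ContinuousOn f (Icc m 1)) (hfp : ∀ u ∈ Icc m 1, 0 < f u)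
    (hell : ContinuousOn ell (Icc m 1))
    (hE : ∀ u ∈ Ioo m 1, (∫ ρ in (0:ℝ)..(M u), ρ * D ρ) = c * ∫ ρ in u..1, (M ρ - ell ρ) / f ρ)
    (hEN : ∀ u ∈ Ioo m 1, (∫ ρ in (0:ℝ)..(N u), ρ * D ρ) = c0 * ∫ ρ in u..1, (N ρ - ell ρ) / f ρ)
    (ht : t ∈ Ioo m 1) (hlt : ∀ u ∈ Ico t 1, N u < M u) :
    ∀ u ∈ Ioo m 1, N u < M u ∧
      c / c0 * (∫ ρ in (0:ℝ)..(N u), ρ * D ρ) ≤ ∫ ρ in (0:ℝ)..(M u), ρ * D ρ := by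
  have hid : ContinuousOn (fun ρ => ρ * D ρ) (Ico (0:ℝ) 1) := continuousOn_id.mul hD
  have hidp : ∀ x ∈ Ioo (0:ℝ) 1, 0 < x * D x := fun x hx => mul_pos hx.1 (hDp x hx)
  have hsm := aux_smono hid hidp
  have key : ∀ u ∈ Ioo m 1, (∀ w ∈ Ioo u 1, N w < M w) →
      c / c0 * (∫ ρ in (0:ℝ)..(N u), ρ * D ρ) ≤ ∫ ρ in (0:ℝ)..(M u), ρ * D ρ := by
    intro u hu hw
    have hsub : Icc u 1 ⊆ Icc m 1 := Icc_subset_Icc_left hu.1.le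
    rw [hE u hu, hEN u hu, ← mul_assoc, div_mul_cancel₀ _ hc0.ne']
    apply mul_le_mul_of_nonneg_left _ (hc0.trans hc).le
    apply integral_mono_on_of_le_Ioo hu.2.le
    · apply ContinuousOn.intervalIntegrable
      rw [uIcc_of_le hu.2.le]
      exact ((hN.sub hell).div hf (fun u hu => (hfp u hu).ne')).mono hsub
    · apply ContinuousOn.intervalIntegrable
      rw [uIcc_of_le hu.2.le]
      exact ((hM.sub hell).div hf (fun u hu => (hfp u hu).ne')).mono hsub
    · intro w hww
      have := hfp w (hsub (Ioo_subset_Icc_self hww))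
      apply div_le_div_of_nonneg_right _ this.le
      linarith [hw w hww]
  have main : ∀ u ∈ Ioo m 1, N u < M u := by
    by_contra! hcon
    obtain ⟨u, hu, hle⟩ := hcon
    have hut : u ≤ t := by
      by_contra! h
      exact absurd (hlt u ⟨h.le, hu.2⟩) (not_lt.2 hle)
    have hsub : Icc u t ⊆ Icc m 1 := Icc_subset_Icc hu.1.le ht.2.le
    have hcl : IsCompact {x | x ∈ Icc u t ∧ M x ≤ N x} := by
      apply isCompact_Icc.of_isClosed_subset
      · exact isClosed_Icc.isClosed_le (hM.mono hsub) (hN.mono hsub)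
      · exact fun x hx => hx.1
    obtain ⟨x, ⟨hx, hxle⟩, hmax⟩ := hcl.exists_isGreatest ⟨u, ⟨le_rfl, hut⟩, hle⟩
    have hxm : x ∈ Ioo m 1 := ⟨hu.1.trans_le hx.1, hx.2.trans_lt ht.2⟩
    have hk := key x hxm (by
      intro w hw
      by_contra! h
      rcases le_total w t with hwt | hwt
      · have := hmax ⟨⟨hx.1.trans hw.1.le, hwt⟩, h⟩
        linarith [hw.1]
      · exact absurd (hlt w ⟨hwt, hw.2⟩) (not_lt.2 h))
    have hMx := Ioo_subset_Ico_self (hMp x hxm)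
    have hNx := Ioo_subset_Ico_self (hNp x hxm)
    have h1 := (hsm.le_iff_le hMx hNx).2 hxle
    have h2 := hsm (show (0:ℝ) ∈ Ico (0:ℝ) 1 by simp) hNx (hNp x hxm).1
    simp only [integral_same] at h1 h2
    have : 1 < c / c0 := (one_lt_div hc0).2 hc
    nlinarith
  exact fun u hu => ⟨main u hu, key u hu (fun w hw => main w ⟨hu.1.trans hw.1, hw.2⟩)⟩

end aux

theorem M_map_bounds_and_small_v_limit
    (lam gam kap : ℝ)
    (hlam : lam ∈ Set.Ioo (0:ℝ) 1) (hgam : gam ∈ Set.Ioo (0:ℝ) 1)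
    (hkap : kap ∈ Set.Ioc (0:ℝ) 1)
    (f f' F : ℝ → ℝ)
    (hf_maps : ∀ x ∈ Set.Icc (0:ℝ) 1, f x ∈ Set.Icc (0:ℝ) 1)
    (hf_mono : StrictMonoOn f (Set.Icc (0:ℝ) 1))
    (hf_deriv : ∀ x ∈ Set.Icc (0:ℝ) 1, HasDerivWithinAt f (f' x) (Set.Icc (0:ℝ) 1) x)
    (hf'_cont : ContinuousOn f' (Set.Icc (0:ℝ) 1))
    (hf_zero : f 0 = 0) (hf'_zero : f' 0 = 1 / kap)
    (hf_one : f 1 ∈ Set.Ioc lam 1)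
    (hF : ∀ s ∈ Set.Ioc (0:ℝ) 1, F s = ∫ ρ in s..1, 1 / f ρ)
    (D : ℝ → ℝ) (a b : ℝ) (ha : 1 < a) (hb : 1 < b)
    (hD_mono : MonotoneOn D (Set.Ico (0:ℝ) 1))
    (hD_nonneg : ∀ m ∈ Set.Ico (0:ℝ) 1, 0 ≤ D m)
    (hD_smooth : ∃ D' : ℝ → ℝ, ContinuousOn D' (Set.Ico (0:ℝ) 1) ∧
      ∀ m ∈ Set.Ico (0:ℝ) 1, HasDerivWithinAt D (D' m) (Set.Ico (0:ℝ) 1) m)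
    (LD0 LD1 : ℝ) (hLD0 : 0 < LD0) (hLD1 : 0 < LD1)
    (hD_zero : Filter.Tendsto (fun m => D m / m ^ a) (nhdsWithin 0 (Set.Ioi 0)) (nhds LD0))
    (hD_one : Filter.Tendsto (fun m => (1 - m) ^ b * D m) (nhdsWithin 1 (Set.Iio 1)) (nhds LD1))
    (ell : ℝ → ℝ)
    (hell : ∀ s ∈ Set.Ioc (0:ℝ) 1, ell s = 1 / gam * ((1 - s) - lam * F s))
    (sInf : ℝ) (hsInf_mem : sInf ∈ Set.Ioo (0:ℝ) 1)
    (hsInf_eq : sInf + lam * F sInf = 1)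
    (hsInf_uniq : ∀ s ∈ Set.Ioo (0:ℝ) 1, s + lam * F s = 1 → s = sInf)
    (sM : ℝ) (hsM_mem : sM ∈ Set.Ioo (0:ℝ) 1) (hsM_eq : f sM = lam)
    (hpar : sM + lam * F sM < 1 - gam)
    (Phi : ℝ → ℝ)
    (hPhi : ∀ m ∈ Set.Ico (0:ℝ) 1, Phi m = ∫ ρ in (0:ℝ)..m, ρ * D ρ)
    (G : ℝ → ℝ)
    (hG : ∀ s ∈ Set.Ioc (0:ℝ) 1, G s = ∫ ρ in s..1, (ρ + lam * F ρ - (1 - gam)) / f ρ)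
    (Mv : ℝ → ℝ → ℝ) (sig : ℝ → ℝ)
    (hMv : ∀ v : ℝ, 0 < v → IsMMap gam v sInf (sig v) f ell Phi (Mv v)) :
    (∀ v0 v : ℝ, 0 < v0 → v0 < v → ∀ s ∈ Set.Ico sInf 1,
      v ^ 2 / v0 ^ 2 * Phi (Mv v0 s) ≤ Phi (Mv v s)) ∧
    (∀ v : ℝ, 0 < v → ∀ s ∈ Set.Ico sInf 1, 0 < Mv v s →
      Phi (Mv v s) ≤ (v / gam) ^ 2 * G s) ∧
    (∀ s ∈ Set.Ico sInf 1,
      Filter.Tendsto (fun v => Mv v s) (nhdsWithin 0 (Set.Ioi 0)) (nhds 0)) := by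
  have hs0 := hsInf_mem.1
  have hs1 := hsInf_mem.2
  have hl0 := hlam.1
  have hg0 := hgam.1
  have hsub01 : Set.Icc sInf 1 ⊆ Set.Icc (0:ℝ) 1 := Set.Icc_subset_Icc_left hs0.le
  have hsubIoc : Set.Icc sInf 1 ⊆ Set.Ioc (0:ℝ) 1 := fun x hx => ⟨hs0.trans_le hx.1, hx.2⟩
  have hfc : ContinuousOn f (Set.Icc sInf 1) :=
    fun x hx => ((hf_deriv x (hsub01 hx)).continuousWithinAt).mono hsub01
  have hfp : ∀ u ∈ Set.Icc sInf 1, 0 < f u := by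
    intro u hu
    have := hf_mono (Set.left_mem_Icc.2 zero_le_one) (hsub01 hu) (hs0.trans_le hu.1)
    rwa [hf_zero] at this
  have hf1 : ∀ u ∈ Set.Icc sInf 1, f u ≤ 1 := fun u hu => (hf_maps u (hsub01 hu)).2
  have hfic : ContinuousOn (fun ρ => 1 / f ρ) (Set.Icc sInf 1) :=
    continuousOn_const.div hfc (fun u hu => (hfp u hu).ne')
  have hFc : ContinuousOn F (Set.Icc sInf 1) := by
    have := intervalIntegral.continuousOn_primitive_interval_left (μ := MeasureTheory.volume)
      (f := fun ρ => 1 / f ρ) (a := sInf) (b := 1) (by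
        rw [Set.uIcc_of_le hs1.le]
        exact hfic.integrableOn_Icc)
    rw [Set.uIcc_of_le hs1.le] at this
    exact this.congr (fun x hx => hF x (hsubIoc hx))
  have hellc : ContinuousOn ell (Set.Icc sInf 1) := by
    have : ContinuousOn (fun s => 1 / gam * ((1 - s) - lam * F s)) (Set.Icc sInf 1) := by fun_prop
    exact this.congr (fun x hx => hell x (hsubIoc hx))
  have hDc : ContinuousOn D (Set.Ico (0:ℝ) 1) := by
    obtain ⟨D', -, h⟩ := hD_smooth
    exact fun x hx => (h x hx).continuousWithinAt
  have hDp : ∀ x ∈ Set.Ioo (0:ℝ) 1, 0 < D x := by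
    intro x hx
    have h1 := hD_zero.eventually_const_lt hLD0
    have h2 : ∀ᶠ y in nhdsWithin (0:ℝ) (Set.Ioi 0), y ∈ Set.Ioo 0 x := Ioo_mem_nhdsGT hx.1
    obtain ⟨y, hy, hyx⟩ := (h1.and h2).exists
    have hya : 0 < y ^ a := Real.rpow_pos_of_pos hyx.1 a
    have hDy : 0 < D y := by
      have := mul_pos hy hya
      rwa [div_mul_cancel₀ _ hya.ne'] at this
    exact hDy.trans_le (hD_mono ⟨hyx.1.le, hyx.2.trans hx.2⟩ ⟨hx.1.le, hx.2⟩ hyx.2.le)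
  have hid : ContinuousOn (fun ρ => ρ * D ρ) (Set.Ico (0:ℝ) 1) := continuousOn_id.mul hDc
  have hsm : StrictMonoOn Phi (Set.Ico (0:ℝ) 1) :=
    (aux_smono hid (fun x hx => mul_pos hx.1 (hDp x hx))).congr (fun m hm => (hPhi m hm).symm)
  have hzero : (0:ℝ) ∈ Set.Ico (0:ℝ) 1 := by simp
  have hPhi0 : Phi 0 = 0 := by rw [hPhi 0 hzero]; simp
  have hell0 : ∀ u ∈ Set.Icc (max sInf sM) 1, 0 ≤ ell u := by
    intro u hu
    have hu' : u ∈ Set.Icc sInf 1 := ⟨(le_max_left _ _).trans hu.1, hu.2⟩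
    rw [hell u (hsubIoc hu'), hF u (hsubIoc hu')]
    have hb : ∫ ρ in u..1, 1 / f ρ ≤ ∫ ρ in u..1, 1 / lam := by
      apply intervalIntegral.integral_mono_on hu.2
      · apply ContinuousOn.intervalIntegrable
        rw [Set.uIcc_of_le hu.2]
        exact hfic.mono (Set.Icc_subset_Icc_left hu'.1)
      · simp
      · intro w hw
        apply one_div_le_one_div_of_le hl0
        rw [← hsM_eq]
        apply hf_mono.monotoneOn ⟨hsM_mem.1.le, hsM_mem.2.le⟩
        · exact hsub01 ⟨hu'.1.trans hw.1, hw.2⟩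
        · exact ((le_max_right _ _).trans hu.1).trans hw.1
    rw [intervalIntegral.integral_const, smul_eq_mul, mul_one_div, le_div_iff₀ hl0] at hb
    apply mul_nonneg (by positivity)
    linarith
  have hellK : ∀ u ∈ Set.Icc sInf 1, ell u ≤ 1 / gam * (1 - u) := by
    intro u hu
    rw [hell u (hsubIoc hu), hF u (hsubIoc hu)]
    apply mul_le_mul_of_nonneg_left _ (by positivity)
    have : 0 ≤ ∫ ρ in u..1, 1 / f ρ := by
      apply intervalIntegral.integral_nonneg hu.2
      intro w hw
      have := hfp w ⟨hu.1.trans hw.1, hw.2⟩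
      positivity
    have := mul_nonneg hl0.le this
    linarith
  have hMmem : ∀ v, 0 < v → ∀ s ∈ Set.Icc sInf 1, Mv v s ∈ Set.Ico (0:ℝ) 1 := by
    intro v hv s hs
    obtain ⟨-, h1, -, hp, hz, -, -⟩ := hMv v hv
    rcases le_or_gt s (sig v) with h | h
    · rw [hz s ⟨hs.1, h⟩]; exact hzero
    · rcases eq_or_lt_of_le hs.2 with h' | h'
      · rw [h', h1]; exact hzero
      · exact Set.Ioo_subset_Ico_self (hp s ⟨h, h'⟩)
  have part2 : ∀ v : ℝ, 0 < v → ∀ s ∈ Set.Ico sInf 1, 0 < Mv v s →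
      Phi (Mv v s) ≤ (v / gam) ^ 2 * G s := by
    intro v hv s hs hpos
    obtain ⟨hc, h1, -, hp, hz, hE, -⟩ := hMv v hv
    have hsig : sig v < s := by
      by_contra! h
      rw [hz s ⟨hs.1, h⟩] at hpos
      exact lt_irrefl _ hpos
    have hsub : Set.Icc s 1 ⊆ Set.Icc sInf 1 := Set.Icc_subset_Icc_left hs.1
    rw [hE s ⟨hsig, hs.2⟩, hG s ⟨hs0.trans_le hs.1, hs.2.le⟩]
    have e : (v / gam) ^ 2 * ∫ ρ in s..1, (ρ + lam * F ρ - (1 - gam)) / f ρ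
        = v ^ 2 / gam * ∫ ρ in s..1, 1 / gam * ((ρ + lam * F ρ - (1 - gam)) / f ρ) := by
      rw [intervalIntegral.integral_const_mul]; ring
    rw [e]
    apply mul_le_mul_of_nonneg_left _ (by positivity)
    apply intervalIntegral.integral_mono_on hs.2.le
    · apply ContinuousOn.intervalIntegrable
      rw [Set.uIcc_of_le hs.2.le]
      exact ((hc.sub hellc).div hfc (fun u hu => (hfp u hu).ne')).mono hsub
    · apply ContinuousOn.intervalIntegrable
      rw [Set.uIcc_of_le hs.2.le]
      refine (continuousOn_const.mul (ContinuousOn.div ?_ hfc (fun u hu => (hfp u hu).ne'))).mono hsub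
      fun_prop
    · intro w hw
      have hw' := hsub hw
      rw [← mul_div_assoc]
      apply div_le_div_of_nonneg_right _ (hfp w hw').le
      rw [hell w (hsubIoc hw')]
      have := (hMmem v hv w hw').2
      have e2 : 1 / gam * (w + lam * F w - (1 - gam)) = 1 - 1 / gam * (1 - w - lam * F w) := by
        field_simp
        ring
      linarith
  refine ⟨?_, part2, ?_⟩
  · intro v0 v hv0 hvv s hs
    have hv : 0 < v := hv0.trans hvv
    obtain ⟨hNc, hN1, hNs, hNp, hNz, hNE, x0, hx0, hNI⟩ := hMv v0 hv0
    obtain ⟨hMc, hM1, hMs, hMp, hMz, hME, x1, hx1, hMI⟩ := hMv v hv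
    rcases le_or_gt s (sig v0) with h | h
    · rw [hNz s ⟨hs.1, h⟩, hPhi0, mul_zero, ← hPhi0]
      have hm := hMmem v hv s ⟨hs.1, hs.2.le⟩
      exact hsm.monotoneOn hzero hm hm.1
    set m := max (sig v0) (sig v) with hm
    have hm1 : m < 1 := max_lt (hx0.1.trans hx0.2) (hx1.1.trans hx1.2)
    have hmI : sInf ≤ m := hNs.1.trans (le_max_left _ _)
    have hsubm : Set.Icc m 1 ⊆ Set.Icc sInf 1 := Set.Icc_subset_Icc_left hmI
    have hc0 : 0 < v0 ^ 2 / gam := by positivity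
    have hcc : v0 ^ 2 / gam < v ^ 2 / gam := by gcongr
    have hMp' : ∀ u ∈ Set.Ioo m 1, Mv v u ∈ Set.Ioo (0:ℝ) 1 :=
      fun u hu => hMp u ⟨(le_max_right _ _).trans_lt hu.1, hu.2⟩
    have hNp' : ∀ u ∈ Set.Ioo m 1, Mv v0 u ∈ Set.Ioo (0:ℝ) 1 :=
      fun u hu => hNp u ⟨(le_max_left _ _).trans_lt hu.1, hu.2⟩
    have hME' : ∀ u ∈ Set.Ioo m 1, (∫ ρ in (0:ℝ)..(Mv v u), ρ * D ρ)
        = v ^ 2 / gam * ∫ ρ in u..1, (Mv v ρ - ell ρ) / f ρ := by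
      intro u hu
      rw [← hPhi _ (Set.Ioo_subset_Ico_self (hMp' u hu))]
      exact hME u ⟨(le_max_right _ _).trans_lt hu.1, hu.2⟩
    have hNE' : ∀ u ∈ Set.Ioo m 1, (∫ ρ in (0:ℝ)..(Mv v0 u), ρ * D ρ)
        = v0 ^ 2 / gam * ∫ ρ in u..1, (Mv v0 ρ - ell ρ) / f ρ := by
      intro u hu
      rw [← hPhi _ (Set.Ioo_subset_Ico_self (hNp' u hu))]
      exact hNE u ⟨(le_max_left _ _).trans_lt hu.1, hu.2⟩
    obtain ⟨r, hr, hr1⟩ : ∃ r, max (max m (max sInf sM)) (max x0 x1) < r ∧ r < 1 :=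
      exists_between (max_lt (max_lt hm1 (max_lt hs1 hsM_mem.2)) (max_lt hx0.2 hx1.2))
    simp only [max_lt_iff] at hr
    have hmr : m < r := hr.1.1
    have hrI : sInf ≤ r := hr.1.2.1.le
    have hsubr : Set.Icc r 1 ⊆ Set.Icc sInf 1 := Set.Icc_subset_Icc_left hrI
    have hsubrm : Set.Ico r 1 ⊆ Set.Ioo m 1 := fun u hu => ⟨hmr.trans_le hu.1, hu.2⟩
    obtain ⟨t, ht, hlt⟩ := near_one (D := D) (M := Mv v) (N := Mv v0) (f := f) (ell := ell)
      (K := 1 / gam) hr1 hc0 hcc (by positivity) hDc hDp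
      (hMc.mono hsubr) hM1 (fun u hu => hMp' u (hsubrm hu))
      (hNc.mono hsubr) hN1 (fun u hu => hNp' u (hsubrm hu))
      (hfc.mono hsubr) (fun u hu => hfp u (hsubr hu)) (fun u hu => hf1 u (hsubr hu))
      (hellc.mono hsubr)
      (fun u hu => hell0 u ⟨max_le (hrI.trans hu.1) (hr.1.2.2.le.trans hu.1), hu.2⟩)
      (fun u hu => hellK u (hsubr hu))
      (fun u hu => hME' u (hsubrm hu)) (fun u hu => hNE' u (hsubrm hu))
      (hMI.mono_set (by
        rw [Set.uIcc_of_le hr1.le, Set.uIcc_of_le hx1.2.le]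
        exact Set.Icc_subset_Icc_left hr.2.2.le))
      (hNI.mono_set (by
        rw [Set.uIcc_of_le hr1.le, Set.uIcc_of_le hx0.2.le]
        exact Set.Icc_subset_Icc_left hr.2.1.le))
    have hglob := global_comp (t := t) hc0 hcc hDc hDp (hMc.mono hsubm) hMp' (hNc.mono hsubm) hNp'
      (hfc.mono hsubm) (fun u hu => hfp u (hsubm hu)) (hellc.mono hsubm) hME' hNE'
      (hsubrm ht) hlt
    have hsig : sig v ≤ sig v0 := by
      by_contra! hcon
      have hmv : m = sig v := max_eq_right hcon.le
      have hle : Mv v0 m ≤ Mv v m := by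
        have hne : (nhdsWithin m (Set.Ioo m 1)).NeBot := left_nhdsWithin_Ioo_neBot hm1
        have hmm : m ∈ Set.Icc sInf 1 := ⟨hmI, hm1.le⟩
        have hss : Set.Ioo m 1 ⊆ Set.Icc sInf 1 := Set.Ioo_subset_Icc_self.trans hsubm
        refine le_of_tendsto_of_tendsto ((hNc m hmm).mono hss) ((hMc m hmm).mono hss) ?_
        filter_upwards [self_mem_nhdsWithin] with u hu
        exact (hglob u hu).1.le
      rw [hMz m ⟨hmI, hmv.le⟩] at hle
      have := (hNp m ⟨hmv ▸ hcon, hm1⟩).1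
      linarith
    have hsm' : s ∈ Set.Ioo m 1 := ⟨max_lt h (hsig.trans_lt h), hs.2⟩
    have hfin := (hglob s hsm').2
    rw [hPhi _ (Set.Ioo_subset_Ico_self (hMp' s hsm')),
      hPhi _ (Set.Ioo_subset_Ico_self (hNp' s hsm'))]
    rwa [div_div_div_cancel_right₀ hg0.ne'] at hfin
  · intro s hs
    have hnn : ∀ᶠ v in nhdsWithin (0:ℝ) (Set.Ioi 0), 0 ≤ Mv v s := by
      filter_upwards [self_mem_nhdsWithin] with v hv
      exact (hMmem v hv s ⟨hs.1, hs.2.le⟩).1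
    rw [Metric.tendsto_nhds]
    intro ε hε
    obtain ⟨d, hd0, hd⟩ := exists_between (lt_min hε one_pos)
    have hdI : d ∈ Set.Ico (0:ℝ) 1 := ⟨hd0.le, hd.trans_le (min_le_right _ _)⟩
    have hPd : 0 < Phi d := by
      have := hsm hzero hdI hd0
      rwa [hPhi0] at this
    have hlim : Filter.Tendsto (fun v : ℝ => (v / gam) ^ 2 * G s) (nhdsWithin 0 (Set.Ioi 0))
        (nhds 0) := by
      have hcont : Continuous (fun v : ℝ => (v / gam) ^ 2 * G s) := by fun_prop
      have := (hcont.tendsto 0).mono_left (nhdsWithin_le_nhds (s := Set.Ioi 0))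
      simpa using this
    filter_upwards [hlim.eventually_lt_const hPd, hnn, self_mem_nhdsWithin] with v hv hv0 hvp
    rw [Real.dist_eq, sub_zero, abs_of_nonneg hv0]
    rcases eq_or_lt_of_le hv0 with h | h
    · rw [← h]; exact hε
    · have h2 := (part2 v hvp s hs h).trans_lt hv
      have := (hsm.lt_iff_lt (hMmem v hvp s ⟨hs.1, hs.2.le⟩) hdI).1 h2
      exact this.trans (hd.trans_le (min_le_left _ _))
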